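/- Let n ≥ 1, γ ∈ (0,1), and let H : ℝⁿ → ℝ be continuous with H(p) = −|p|^γ for |p| ≤ 1 and H(p) = f(p) for |p| ≥ 1, where f : ℝⁿ → ℝ is continuous and coercive with f(p) = −1 for |p| ≤ 1 and min_{ℝⁿ} f = −1. Then for every k > 0 the function u_k(x) = [((1−γ)/γ)(k + γ/(1−γ) − |x|)]^{γ/(γ−1)}, defined for x in the closure of B(0,k), is the unique state-constraint viscosity solution of u(x) + H(Du(x)) = 0 on B(0,k). As a consequence, for every R > 0 there is a constant C > 0 (depending on γ and R) such that 0 ≤ u_k(x) ≤ C k^{−γ/(1−γ)} for all |x| ≤ R and k ≥ R + 1, i.e. u_k → 0 locally uniformly with rate O(k^{−γ/(1−γ)}). -/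

import Mathlib

open Metric Set MeasureTheory Filter
open scoped Topology NNReal RealInnerProductSpace

noncomputable section

abbrev Euc (n : ℕ) := EuclideanSpace ℝ (Fin n)

/-- `v` is a viscosity subsolution of `v + H(x, Dv) = 0` in the open set `Ω`. -/
def IsViscositySubsolutionIn {n : ℕ} (Ω : Set (Euc n)) (H : Euc n → Euc n → ℝ)
    (v : Euc n → ℝ) : Prop :=
  ∀ x ∈ Ω, ∀ φ : Euc n → ℝ, ContDiff ℝ 1 φ →
    IsLocalMaxOn (fun y => v y - φ y) Ω x → v x + H x (gradient φ x) ≤ 0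

/-- `v` is a viscosity supersolution of `v + H(x, Dv) = 0` on the closure of `Ω`. -/
def IsViscositySupersolutionOn {n : ℕ} (Ω : Set (Euc n)) (H : Euc n → Euc n → ℝ)
    (v : Euc n → ℝ) : Prop :=
  ∀ x ∈ closure Ω, ∀ φ : Euc n → ℝ, ContDiff ℝ 1 φ →
    IsLocalMinOn (fun y => v y - φ y) (closure Ω) x → 0 ≤ v x + H x (gradient φ x)

/-- `v` is a state-constraint viscosity solution on `Ω`. -/
def IsStateConstraintSolution {n : ℕ} (Ω : Set (Euc n)) (H : Euc n → Euc n → ℝ)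
    (v : Euc n → ℝ) : Prop :=
  ContinuousOn v (closure Ω) ∧ IsViscositySubsolutionIn Ω H v ∧
    IsViscositySupersolutionOn Ω H v


def Sf (γ k r : ℝ) : ℝ := ((1 - γ) / γ) * (k + γ / (1 - γ) - r)

def Uf (γ k r : ℝ) : ℝ := (Sf γ k r) ^ (γ / (γ - 1))

def mf (γ k r : ℝ) : ℝ := (Sf γ k r) ^ (1 / (γ - 1))

lemma Sf_eq {γ : ℝ} (h0 : 0 < γ) (h1 : γ < 1) (k r : ℝ) :
    Sf γ k r = 1 + ((1 - γ) / γ) * (k - r) := by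
  have : 1 - γ ≠ 0 := by linarith
  unfold Sf
  field_simp
  ring

lemma Sf_ge_one {γ : ℝ} (h0 : 0 < γ) (h1 : γ < 1) {k r : ℝ} (h : r ≤ k) : 1 ≤ Sf γ k r := by
  rw [Sf_eq h0 h1]
  have : 0 < (1 - γ) / γ := div_pos (by linarith) h0
  nlinarith [mul_nonneg this.le (sub_nonneg.2 h)]

lemma Sf_anti {γ : ℝ} (h0 : 0 < γ) (h1 : γ < 1) {k r r' : ℝ} (h : r ≤ r') :
    Sf γ k r' ≤ Sf γ k r := by
  rw [Sf_eq h0 h1, Sf_eq h0 h1]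
  have : 0 < (1 - γ) / γ := div_pos (by linarith) h0
  nlinarith [mul_nonneg this.le (sub_nonneg.2 h)]

lemma Sf_cont (γ k : ℝ) : Continuous (Sf γ k) := by
  unfold Sf; fun_prop

lemma b_neg {γ : ℝ} (h0 : 0 < γ) (h1 : γ < 1) : γ / (γ - 1) < 0 :=
  div_neg_of_pos_of_neg h0 (by linarith)

lemma Uf_mono {γ : ℝ} (h0 : 0 < γ) (h1 : γ < 1) {k r r' : ℝ} (h : r ≤ r')
    (hS : 0 < Sf γ k r') : Uf γ k r ≤ Uf γ k r' :=
  Real.rpow_le_rpow_of_nonpos hS (Sf_anti h0 h1 h) (b_neg h0 h1).le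

lemma Uf_k {γ : ℝ} (h0 : 0 < γ) (h1 : γ < 1) (k : ℝ) : Uf γ k k = 1 := by
  simp [Uf, Sf_eq h0 h1]

lemma mf_pos {γ k r : ℝ} (hS : 0 < Sf γ k r) : 0 < mf γ k r := Real.rpow_pos_of_pos hS _

lemma mf_le_one {γ : ℝ} (h0 : 0 < γ) (h1 : γ < 1) {k r : ℝ} (h : r ≤ k) : mf γ k r ≤ 1 :=
  Real.rpow_le_one_of_one_le_of_nonpos (Sf_ge_one h0 h1 h)
    (div_nonpos_of_nonneg_of_nonpos zero_le_one (by linarith))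

lemma mf_rpow {γ k r : ℝ} (hS : 0 < Sf γ k r) : (mf γ k r) ^ γ = Uf γ k r := by
  unfold mf Uf
  rw [← Real.rpow_mul hS.le]
  congr 1
  ring

lemma Sf_deriv (γ k r : ℝ) : HasDerivAt (Sf γ k) (-((1 - γ) / γ)) r := by
  have := ((hasDerivAt_id r).const_sub (k + γ / (1 - γ))).const_mul ((1 - γ) / γ)
  simpa [Sf] using! this

lemma Uf_deriv {γ : ℝ} (h0 : 0 < γ) (h1 : γ < 1) {k r : ℝ} (hS : 0 < Sf γ k r) :
    HasDerivAt (Uf γ k) (mf γ k r) r := by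
  have := (Sf_deriv γ k r).rpow_const (p := γ / (γ - 1)) (Or.inl hS.ne')
  have e1 : γ / (γ - 1) - 1 = 1 / (γ - 1) := by
    have : γ - 1 ≠ 0 := by linarith
    field_simp; ring
  have e2 : -((1 - γ) / γ) * (γ / (γ - 1)) = 1 := by
    have : γ - 1 ≠ 0 := by linarith
    field_simp; ring
  rw [e1, e2, one_mul] at this
  exact this

lemma Uf_tangent {γ : ℝ} (h0 : 0 < γ) (h1 : γ < 1) {k r r0 : ℝ} (hS : 0 < Sf γ k r)
    (hS0 : 0 < Sf γ k r0) : Uf γ k r0 + mf γ k r0 * (r - r0) ≤ Uf γ k r := by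
  have hb := b_neg h0 h1
  have g1 : γ - 1 ≠ 0 := by linarith
  set b := γ / (γ - 1) with hbdef
  set t := Sf γ k r / Sf γ k r0 with ht
  have htpos : 0 < t := div_pos hS hS0
  have h2 : 1 + b * (t - 1) ≤ t ^ b := by
    rw [Real.rpow_def_of_pos htpos]
    have a1 := Real.add_one_le_exp (Real.log t * b)
    have a2 := Real.log_le_sub_one_of_pos htpos
    nlinarith
  have hU0 : 0 < Uf γ k r0 := Real.rpow_pos_of_pos hS0 _
  have hU : Uf γ k r = Uf γ k r0 * t ^ b := by
    unfold Uf
    rw [← Real.mul_rpow hS0.le htpos.le, ht]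
    congr 1
    field_simp
  have hm : mf γ k r0 = Uf γ k r0 / Sf γ k r0 := by
    unfold mf Uf
    rw [← Real.rpow_sub_one hS0.ne']
    congr 1
    field_simp; ring
  have hlin : b * (t - 1) * Sf γ k r0 = r - r0 := by
    rw [ht]
    have : b * (Sf γ k r / Sf γ k r0 - 1) * Sf γ k r0 = b * (Sf γ k r - Sf γ k r0) := by
      field_simp
    rw [this, Sf_eq h0 h1, Sf_eq h0 h1, hbdef]
    field_simp; ring
  rw [hU, hm, ← hlin]
  have : Uf γ k r0 / Sf γ k r0 * (b * (t - 1) * Sf γ k r0) = Uf γ k r0 * (b * (t - 1)) := by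
    field_simp
  rw [this]
  nlinarith [mul_le_mul_of_nonneg_left h2 hU0.le]

lemma H_ge {n : ℕ} {γ : ℝ} (h0 : 0 < γ) {H : Euc n → ℝ}
    (hHsmall : ∀ p : Euc n, ‖p‖ ≤ 1 → H p = -(‖p‖ ^ γ))
    (hHbig : ∀ p : Euc n, 1 ≤ ‖p‖ → -1 ≤ H p) (p : Euc n) {m : ℝ} (h : ‖p‖ ≤ m) :
    -(m ^ γ) ≤ H p := by
  have hm : ‖p‖ ^ γ ≤ m ^ γ := Real.rpow_le_rpow (norm_nonneg _) h h0.le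
  rcases le_total ‖p‖ 1 with h1 | h1
  · rw [hHsmall p h1]; linarith
  · have := hHbig p h1
    have := Real.one_le_rpow h1 h0.le
    linarith

lemma H_ge_one {n : ℕ} {γ : ℝ} (h0 : 0 < γ) {H : Euc n → ℝ}
    (hHsmall : ∀ p : Euc n, ‖p‖ ≤ 1 → H p = -(‖p‖ ^ γ))
    (hHbig : ∀ p : Euc n, 1 ≤ ‖p‖ → -1 ≤ H p) (p : Euc n) : -1 ≤ H p := by
  rcases le_total ‖p‖ 1 with h1 | h1
  · simpa using H_ge h0 hHsmall hHbig p h1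
  · exact hHbig p h1

lemma exists_unit {n : ℕ} (hn : 1 ≤ n) (x : Euc n) : ∃ e : Euc n, ‖e‖ = 1 ∧ ⟪e, x⟫ = ‖x‖ := by
  by_cases hx : x = 0
  · subst hx
    haveI : Nontrivial (Euc n) := by
      haveI : Nonempty (Fin n) := ⟨⟨0, hn⟩⟩
      infer_instance
    obtain ⟨e, he⟩ := exists_norm_eq (Euc n) (zero_le_one (α := ℝ))
    exact ⟨e, he, by simp⟩
  · have h : ‖x‖ ≠ 0 := norm_ne_zero_iff.2 hx
    refine ⟨‖x‖⁻¹ • x, ?_, ?_⟩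
    · rw [norm_smul, norm_inv, norm_norm, inv_mul_cancel₀ h]
    · rw [real_inner_smul_left, real_inner_self_eq_norm_sq]
      field_simp

/-- The supporting affine function. -/
def aff {n : ℕ} (γ k : ℝ) (e x0 x : Euc n) : ℝ :=
  Uf γ k ‖x0‖ + mf γ k ‖x0‖ * (⟪e, x⟫ - ‖x0‖)

lemma aff_contDiff {n : ℕ} (γ k : ℝ) (e x0 : Euc n) : ContDiff ℝ 1 (aff γ k e x0) := by
  exact contDiff_const.add (contDiff_const.mul
    ((contDiff_const.inner ℝ contDiff_id).sub contDiff_const))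

lemma aff_grad {n : ℕ} (γ k : ℝ) (e x0 x : Euc n) :
    HasGradientAt (aff γ k e x0) (mf γ k ‖x0‖ • e) x := by
  rw [hasGradientAt_iff_hasFDerivAt]
  have h := (((InnerProductSpace.toDual ℝ (Euc n) e).hasFDerivAt (x := x)).sub_const
    ‖x0‖).const_mul (mf γ k ‖x0‖) |>.const_add (Uf γ k ‖x0‖)
  rw [map_smulₛₗ]
  exact h

lemma aff_self {n : ℕ} (γ k : ℝ) {e x0 : Euc n} (he : ⟪e, x0⟫ = ‖x0‖) :
    aff γ k e x0 x0 = Uf γ k ‖x0‖ := by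
  simp [aff, he]

lemma aff_le {n : ℕ} {γ : ℝ} (h0 : 0 < γ) (h1 : γ < 1) {k : ℝ} {e x0 x : Euc n} (he : ‖e‖ = 1)
    (hx0 : 0 < Sf γ k ‖x0‖) (hx : 0 < Sf γ k ‖x‖) : aff γ k e x0 x ≤ Uf γ k ‖x‖ := by
  refine le_trans ?_ (Uf_tangent h0 h1 hx hx0)
  have : ⟪e, x⟫ ≤ ‖x‖ := by simpa [he] using real_inner_le_norm e x
  unfold aff
  have := mul_le_mul_of_nonneg_left (sub_le_sub_right this ‖x0‖) (mf_pos hx0).le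
  linarith

lemma H_aff {n : ℕ} {γ : ℝ} (h0 : 0 < γ) (h1 : γ < 1) {H : Euc n → ℝ}
    (hHsmall : ∀ p : Euc n, ‖p‖ ≤ 1 → H p = -(‖p‖ ^ γ)) {k : ℝ} {e x0 : Euc n} (he : ‖e‖ = 1)
    (hx0 : ‖x0‖ ≤ k) : H (mf γ k ‖x0‖ • e) = - Uf γ k ‖x0‖ := by
  have hS : 0 < Sf γ k ‖x0‖ := lt_of_lt_of_le one_pos (Sf_ge_one h0 h1 hx0)
  have hn : ‖mf γ k ‖x0‖ • e‖ = mf γ k ‖x0‖ := by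
    rw [norm_smul, he, mul_one, Real.norm_of_nonneg (mf_pos hS).le]
  rw [hHsmall _ (by rw [hn]; exact mf_le_one h0 h1 hx0), hn, mf_rpow hS]

lemma nonneg_of_right_min {g : ℝ → ℝ} {c : ℝ} (hg : HasDerivAt g c 0)
    (h : ∀ᶠ t in 𝓝[>] (0:ℝ), g 0 ≤ g t) : 0 ≤ c := by
  have := (hasDerivWithinAt_iff_tendsto_slope' (self_notMem_Ioi (a := (0:ℝ)))).1
    (hg.hasDerivWithinAt (s := Ioi 0))
  refine ge_of_tendsto this ?_
  filter_upwards [h, self_mem_nhdsWithin] with t ht ht0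
  rw [slope_def_field]
  exact div_nonneg (by linarith) (by simpa using le_of_lt ht0)

lemma exists_global {n : ℕ} {φ : Euc n → ℝ} {x0 : Euc n} (h : ContDiffAt ℝ 1 φ x0) :
    ∃ ψ : Euc n → ℝ, ContDiff ℝ 1 ψ ∧ ψ =ᶠ[𝓝 x0] φ := by
  have h' : ∀ᶠ y in 𝓝 x0, ContDiffAt ℝ 1 φ y := h.eventually (by simp)
  obtain ⟨r, hr, hb⟩ := Metric.eventually_nhds_iff_ball.1 h'
  let B : ContDiffBump x0 := ⟨r / 4, r / 2, by positivity, by linarith⟩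
  refine ⟨fun y => B y * φ y, ?_, ?_⟩
  · rw [contDiff_iff_contDiffAt]
    intro y
    by_cases hy : y ∈ ball x0 r
    · exact B.contDiffAt.mul (hb y hy)
    · have : (fun y => B y * φ y) =ᶠ[𝓝 y] fun _ => 0 := by
        have hy' : y ∈ (closedBall x0 (r / 2))ᶜ := by
          simp only [mem_ball, not_lt, mem_compl_iff, mem_closedBall, not_le] at hy ⊢
          linarith
        filter_upwards [isClosed_closedBall.isOpen_compl.mem_nhds hy'] with z hz
        have : B z = 0 := B.zero_of_le_dist (by
          simp only [mem_compl_iff, mem_closedBall, not_le] at hz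
          exact hz.le)
        simp [this]
      exact contDiffAt_const.congr_of_eventuallyEq this
  · filter_upwards [B.eventuallyEq_one] with z hz
    simp [hz]

lemma sub_local {n : ℕ} {Ω : Set (Euc n)} {H : Euc n → Euc n → ℝ} {v : Euc n → ℝ}
    (hv : IsViscositySubsolutionIn Ω H v) {x : Euc n} (hx : x ∈ Ω) {φ : Euc n → ℝ}
    (hφ : ContDiffAt ℝ 1 φ x) (hmax : ∀ y ∈ Ω, v y - φ y ≤ v x - φ x) :
    v x + H x (gradient φ x) ≤ 0 := by
  obtain ⟨ψ, hψ, he⟩ := exists_global hφ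
  have := hv x hx ψ hψ (by
    filter_upwards [self_mem_nhdsWithin, mem_nhdsWithin_of_mem_nhds he] with y hy hye
    have hx' := he.self_of_nhds
    change ψ y = φ y at hye
    change v y - ψ y ≤ v x - ψ x
    rw [hye, hx']
    exact hmax y hy)
  have hg : gradient ψ x = gradient φ x := by
    unfold gradient; rw [he.fderiv_eq]
  rwa [hg] at this

lemma norm_gradient' {n : ℕ} (φ : Euc n → ℝ) (x : Euc n) :
    ‖gradient φ x‖ = ‖fderiv ℝ φ x‖ := by
  rw [← toDual_gradient, LinearIsometryEquiv.norm_map]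

lemma v_le_one {n : ℕ} {k : ℝ} {H : Euc n → ℝ} (hH : ∀ p, -1 ≤ H p) {v : Euc n → ℝ}
    (hc : ContinuousOn v (closure (ball 0 k)))
    (hv : IsViscositySubsolutionIn (ball 0 k) (fun _ p => H p) v) :
    ∀ x ∈ closure (ball (0 : Euc n) k), v x ≤ 1 := by
  refine le_on_closure ?_ hc continuousOn_const
  intro z hz
  obtain ⟨r, hr, hb⟩ := Metric.nhds_basis_closedBall.mem_iff.1 (isOpen_ball.mem_nhds hz)
  have hcb : ContinuousOn v (closedBall z r) := hc.mono (hb.trans subset_closure)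
  obtain ⟨M, hM⟩ := (isCompact_closedBall z r).exists_bound_of_continuousOn hcb
  have hM0 : 0 ≤ M := le_trans (norm_nonneg _) (hM z (mem_closedBall_self hr.le))
  let C : ℝ := (2 * M + 1) / r ^ 2
  have hC : 0 < C := by positivity
  let φ : Euc n → ℝ := fun y => C * ‖y - z‖ ^ 2
  have hφ : ContDiff ℝ 1 φ := by
    exact contDiff_const.mul ((contDiff_id.sub contDiff_const).norm_sq ℝ)
  obtain ⟨x, hx, hmax⟩ := (isCompact_closedBall z r).exists_isMaxOn
    ⟨z, mem_closedBall_self hr.le⟩ (hcb.sub hφ.continuous.continuousOn)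
  have h1 : v z ≤ v x - φ x := by
    have := hmax (mem_closedBall_self hr.le)
    simpa [φ] using this
  have hxr : x ∈ ball z r := by
    rw [mem_ball]
    by_contra hlt
    have hd : ‖x - z‖ = r := by
      rw [← dist_eq_norm]; exact le_antisymm hx (not_lt.1 hlt)
    have : φ x = 2 * M + 1 := by
      simp only [φ, C, hd]; field_simp
    have a1 := abs_le.1 (hM x hx)
    have a2 := abs_le.1 (hM z (mem_closedBall_self hr.le))
    linarith [a1.2, a2.1]
  have h2 := hv x (hb hx) φ hφ (by
    filter_upwards [mem_nhdsWithin_of_mem_nhds (isOpen_ball.mem_nhds hxr)] with y hy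
    exact hmax (ball_subset_closedBall hy))
  have h3 : 0 ≤ φ x := by positivity
  have := hH (gradient φ x)
  simp only at h2
  linarith

lemma rho_bound {n : ℕ} {ε : ℝ} (hε : 0 < ε) (x : Euc n) :
    ‖x‖ ≤ √(‖x‖ ^ 2 + ε ^ 2) ∧ √(‖x‖ ^ 2 + ε ^ 2) ≤ ‖x‖ + ε := by
  constructor
  · apply Real.le_sqrt_of_sq_le; nlinarith
  · apply Real.sqrt_le_iff.2 ⟨by positivity, ?_⟩
    nlinarith [norm_nonneg x, mul_nonneg (norm_nonneg x) hε.le]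

lemma rho_contDiff {n : ℕ} {ε : ℝ} (hε : 0 < ε) :
    ContDiff ℝ 1 (fun x : Euc n => √(‖x‖ ^ 2 + ε ^ 2)) := by
  apply ContDiff.sqrt
  · exact (contDiff_id.norm_sq ℝ).add contDiff_const
  · intro x; positivity

lemma rho_fderiv {n : ℕ} {ε : ℝ} (hε : 0 < ε) (x : Euc n) :
    ‖fderiv ℝ (fun x : Euc n => √(‖x‖ ^ 2 + ε ^ 2)) x‖ ≤ 1 := by
  have hpos : 0 < √(‖x‖ ^ 2 + ε ^ 2) := by positivity
  have h := (((hasStrictFDerivAt_norm_sq x).hasFDerivAt).add_const (ε ^ 2)).sqrt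
    (by positivity)
  rw [h.fderiv]
  rw [norm_smul, ← Nat.cast_smul_eq_nsmul ℝ, norm_smul, innerSL_apply_norm, Real.norm_of_nonneg (by positivity)]
  have := (rho_bound hε x).1
  simp only [Nat.cast_ofNat, Real.norm_ofNat]
  rw [div_mul_eq_mul_div, div_le_one (by positivity)]
  linarith

lemma v_le {n : ℕ} {γ : ℝ} (h0 : 0 < γ) (h1 : γ < 1) {k : ℝ} (hk : 0 < k) {H : Euc n → ℝ}
    (hHsmall : ∀ p : Euc n, ‖p‖ ≤ 1 → H p = -(‖p‖ ^ γ))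
    (hHbig : ∀ p : Euc n, 1 ≤ ‖p‖ → -1 ≤ H p) {v : Euc n → ℝ}
    (hc : ContinuousOn v (closure (ball 0 k)))
    (hv : IsViscositySubsolutionIn (ball 0 k) (fun _ p => H p) v) :
    ∀ x ∈ closure (ball (0 : Euc n) k), v x ≤ Uf γ k ‖x‖ := by
  have hone := v_le_one (H_ge_one h0 hHsmall hHbig) hc hv
  rw [closure_ball _ hk.ne'] at hc hone ⊢
  have ha : 0 < (1 - γ) / γ := div_pos (by linarith) h0
  have hε : ∀ ε, 0 < ε → ε < γ / (1 - γ) → ∀ x ∈ closedBall (0 : Euc n) k,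
      v x ≤ Uf γ k (√(‖x‖ ^ 2 + ε ^ 2)) := by
    intro ε hε hε1
    have hSpos : ∀ x ∈ closedBall (0 : Euc n) k, 0 < Sf γ k (√(‖x‖ ^ 2 + ε ^ 2)) := by
      intro x hx
      rw [mem_closedBall_zero_iff] at hx
      have := (rho_bound hε x).2
      unfold Sf
      exact mul_pos ha (by linarith)
    let h : Euc n → ℝ := fun x => Uf γ k (√(‖x‖ ^ 2 + ε ^ 2))
    have hcd : ∀ x ∈ closedBall (0 : Euc n) k, ContDiffAt ℝ 1 h x := by
      intro x hx
      have hS : ContDiff ℝ 1 (Sf γ k) := by unfold Sf; fun_prop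
      exact ((hS.comp (rho_contDiff hε)).contDiffAt).rpow_const_of_ne (hSpos x hx).ne'
    have hhc : ContinuousOn h (closedBall 0 k) := fun x hx =>
      (hcd x hx).continuousAt.continuousWithinAt
    obtain ⟨x0, hx0, hmax⟩ := (isCompact_closedBall (0 : Euc n) k).exists_isMaxOn
      ⟨0, mem_closedBall_self hk.le⟩ (hc.sub hhc)
    have key : v x0 ≤ h x0 := by
      by_cases hb : x0 ∈ ball (0 : Euc n) k
      · have h2 := sub_local hv hb (hcd x0 hx0) (fun y hy => hmax (ball_subset_closedBall hy))
        have hd := (Uf_deriv h0 h1 (hSpos x0 hx0)).comp_hasFDerivAt x0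
          ((rho_contDiff hε).differentiable (by simp) x0).hasFDerivAt
        have hn : ‖gradient h x0‖ ≤ mf γ k (√(‖x0‖ ^ 2 + ε ^ 2)) := by
          rw [norm_gradient', HasFDerivAt.fderiv (f := h) hd, norm_smul,
            Real.norm_of_nonneg (mf_pos (hSpos x0 hx0)).le]
          exact mul_le_of_le_one_right (mf_pos (hSpos x0 hx0)).le (rho_fderiv hε x0)
        have h3 := H_ge h0 hHsmall hHbig _ hn
        rw [mf_rpow (hSpos x0 hx0)] at h3
        simp only [h] at h2 h3 ⊢
        linarith
      · have hxk : k ≤ ‖x0‖ := by simpa using hb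
        calc v x0 ≤ 1 := hone x0 hx0
          _ = Uf γ k k := (Uf_k h0 h1 k).symm
          _ ≤ h x0 := Uf_mono h0 h1 (hxk.trans (rho_bound hε x0).1) (hSpos x0 hx0)
    intro x hx
    have := hmax hx
    simp only [mem_setOf_eq, Pi.sub_apply] at this
    change v x ≤ h x
    linarith
  intro x hx
  have hSx : 0 < Sf γ k ‖x‖ :=
    lt_of_lt_of_le one_pos (Sf_ge_one h0 h1 (by simpa using hx))
  have hlim : Tendsto (fun ε : ℝ => Uf γ k (√(‖x‖ ^ 2 + ε ^ 2))) (𝓝[>] 0) (𝓝 (Uf γ k ‖x‖)) := by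
    have hU : Tendsto (Uf γ k) (𝓝 ‖x‖) (𝓝 (Uf γ k ‖x‖)) := (Uf_deriv h0 h1 hSx).continuousAt
    refine hU.comp (tendsto_nhdsWithin_of_tendsto_nhds ?_)
    have : Continuous (fun ε : ℝ => √(‖x‖ ^ 2 + ε ^ 2)) := by fun_prop
    simpa using this.tendsto 0
  refine ge_of_tendsto hlim ?_
  have hb : 0 < γ / (1 - γ) := div_pos h0 (by linarith)
  filter_upwards [Ioo_mem_nhdsGT hb] with ε he
  exact hε ε he.1 he.2 x hx

lemma v_ge {n : ℕ} (hn : 1 ≤ n) {γ : ℝ} (h0 : 0 < γ) (h1 : γ < 1) {k : ℝ} (hk : 0 < k)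
    {H : Euc n → ℝ}
    (hHsmall : ∀ p : Euc n, ‖p‖ ≤ 1 → H p = -(‖p‖ ^ γ)) {v : Euc n → ℝ}
    (hc : ContinuousOn v (closure (ball 0 k)))
    (hv : IsViscositySupersolutionOn (ball 0 k) (fun _ p => H p) v) :
    ∀ x ∈ closure (ball (0 : Euc n) k), Uf γ k ‖x‖ ≤ v x := by
  unfold IsViscositySupersolutionOn at hv
  rw [closure_ball _ hk.ne'] at hc hv ⊢
  have hS : ∀ x ∈ closedBall (0 : Euc n) k, 0 < Sf γ k ‖x‖ := fun x hx =>
    lt_of_lt_of_le one_pos (Sf_ge_one h0 h1 (by simpa using hx))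
  have hUc : ContinuousOn (fun x : Euc n => Uf γ k ‖x‖) (closedBall 0 k) := fun x hx =>
    ((Uf_deriv h0 h1 (hS x hx)).continuousAt.comp
      (f := fun x : Euc n => ‖x‖) continuous_norm.continuousAt).continuousWithinAt
  obtain ⟨x0, hx0, hmin⟩ := (isCompact_closedBall (0 : Euc n) k).exists_isMinOn
      ⟨0, mem_closedBall_self hk.le⟩ (hc.sub hUc)
  obtain ⟨e, he, hex⟩ := exists_unit hn x0
  have hmin' : ∀ y ∈ closedBall (0 : Euc n) k, v x0 - Uf γ k ‖x0‖ ≤ v y - Uf γ k ‖y‖ :=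
    fun y hy => hmin hy
  have h2 := hv x0 hx0 (aff γ k e x0) (aff_contDiff γ k e x0) (by
    filter_upwards [self_mem_nhdsWithin] with y hy
    rw [aff_self γ k hex]
    have := aff_le h0 h1 he (hS x0 hx0) (hS y hy)
    linarith [hmin' y hy])
  beta_reduce at h2
  rw [(aff_grad γ k e x0 x0).gradient, H_aff h0 h1 hHsmall he (by simpa using hx0)] at h2
  intro x hx
  linarith [hmin' x hx]

lemma u_sol {n : ℕ} (hn : 1 ≤ n) {γ : ℝ} (h0 : 0 < γ) (h1 : γ < 1) {k : ℝ} (hk : 0 < k)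
    {H : Euc n → ℝ}
    (hHsmall : ∀ p : Euc n, ‖p‖ ≤ 1 → H p = -(‖p‖ ^ γ))
    (hHbig : ∀ p : Euc n, 1 ≤ ‖p‖ → -1 ≤ H p) :
    IsStateConstraintSolution (ball (0 : Euc n) k) (fun _ p => H p)
      (fun x => Uf γ k ‖x‖) := by
  have hS : ∀ x ∈ closedBall (0 : Euc n) k, 0 < Sf γ k ‖x‖ := fun x hx =>
    lt_of_lt_of_le one_pos (Sf_ge_one h0 h1 (by simpa using hx))
  refine ⟨?_, ?_, ?_⟩
  · rw [closure_ball _ hk.ne']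
    exact fun x hx => ((Uf_deriv h0 h1 (hS x hx)).continuousAt.comp
      (f := fun x : Euc n => ‖x‖) continuous_norm.continuousAt).continuousWithinAt
  · intro x0 hx0 φ hφ hmax
    have hx0' := ball_subset_closedBall hx0
    obtain ⟨e, he, hex⟩ := exists_unit hn x0
    have hloc : IsLocalMax (fun y => aff γ k e x0 y - φ y) x0 := by
      have hm := hmax
      rw [IsLocalMaxOn, isOpen_ball.nhdsWithin_eq hx0] at hm
      filter_upwards [hm, isOpen_ball.mem_nhds hx0] with y hy hyb
      have := aff_le h0 h1 he (hS x0 hx0') (hS y (ball_subset_closedBall hyb))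
      simp only [aff_self γ k hex] at hy ⊢
      linarith
    have hz := hloc.hasFDerivAt_eq_zero ((hasGradientAt_iff_hasFDerivAt.1
      (aff_grad γ k e x0 x0)).sub (hφ.differentiable (by simp) x0).hasFDerivAt)
    have hg : gradient φ x0 = mf γ k ‖x0‖ • e := by
      rw [sub_eq_zero] at hz
      unfold gradient
      rw [← hz]
      simp
    simp only
    rw [hg, H_aff h0 h1 hHsmall he (by simpa using hx0')]
    simp
  · intro x0 hx0 φ hφ hmin
    rw [closure_ball _ hk.ne'] at hx0 hmin
    by_cases hb : x0 ∈ ball (0 : Euc n) k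
    · have hm := hmin
      rw [IsLocalMinOn, IsMinFilter,
        nhdsWithin_eq_nhds.2 (mem_of_superset (isOpen_ball.mem_nhds hb) ball_subset_closedBall)] at hm
      set w := gradient φ x0 with hw
      have hline : HasDerivAt (fun t : ℝ => x0 + t • w) w 0 := by
        simpa using ((hasDerivAt_id (0:ℝ)).smul_const w).const_add x0
      have hφd : HasDerivAt (fun t : ℝ => φ (x0 + t • w)) (‖w‖ ^ 2) 0 := by
        have hf : HasFDerivAt φ (fderiv ℝ φ x0) (x0 + (0:ℝ) • w) := by
          simpa using (hφ.differentiable (by simp) x0).hasFDerivAt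
        have := hf.comp_hasDerivAt (0:ℝ) hline
        rwa [← inner_gradient_left, ← hw, real_inner_self_eq_norm_sq] at this
      have hUd : HasDerivAt (fun t : ℝ => Uf γ k (‖x0‖ + t * ‖w‖)) (mf γ k ‖x0‖ * ‖w‖) 0 := by
        have hl : HasDerivAt (fun t : ℝ => ‖x0‖ + t * ‖w‖) ‖w‖ 0 := by
          simpa using ((hasDerivAt_id (0:ℝ)).mul_const ‖w‖).const_add ‖x0‖
        have hu : HasDerivAt (Uf γ k) (mf γ k ‖x0‖) (‖x0‖ + 0 * ‖w‖) := by
          simpa using Uf_deriv h0 h1 (hS x0 hx0)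
        exact hu.comp (0:ℝ) hl
      have hc := nonneg_of_right_min (hUd.sub hφd) (by
        have e1 : ∀ᶠ t in 𝓝[>] (0:ℝ), 0 < Sf γ k (‖x0‖ + t * ‖w‖) := by
          have hcont : Continuous (fun t : ℝ => Sf γ k (‖x0‖ + t * ‖w‖)) :=
            (Sf_cont γ k).comp (by fun_prop)
          apply mem_nhdsWithin_of_mem_nhds
          exact hcont.continuousAt.eventually_const_lt (by simpa using hS x0 hx0)
        have e2 : ∀ᶠ t in 𝓝[>] (0:ℝ), Uf γ k ‖x0‖ - φ x0 ≤
            Uf γ k ‖x0 + t • w‖ - φ (x0 + t • w) := by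
          apply mem_nhdsWithin_of_mem_nhds
          have : Tendsto (fun t : ℝ => x0 + t • w) (𝓝 0) (𝓝 x0) := by
            simpa using hline.continuousAt.tendsto
          exact this.eventually hm
        filter_upwards [e1, e2, self_mem_nhdsWithin] with t ht1 ht2 ht
        have htri : ‖x0 + t • w‖ ≤ ‖x0‖ + t * ‖w‖ := by
          refine (norm_add_le _ _).trans ?_
          rw [norm_smul, Real.norm_of_nonneg (le_of_lt ht)]
        have := Uf_mono h0 h1 htri ht1
        simp only [Pi.sub_apply, zero_smul, zero_mul, add_zero]
        linarith)
      have hle : ‖w‖ ≤ mf γ k ‖x0‖ := by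
        by_contra hlt
        push Not at hlt
        have := mf_pos (hS x0 hx0)
        nlinarith
      have := H_ge h0 hHsmall hHbig w hle
      rw [mf_rpow (hS x0 hx0)] at this
      simp only
      linarith
    · have hxk : ‖x0‖ = k := le_antisymm (by simpa using hx0) (by simpa using hb)
      have := H_ge_one h0 hHsmall hHbig (gradient φ x0)
      simp only [hxk, Uf_k h0 h1]
      linarith

lemma rate {γ : ℝ} (h0 : 0 < γ) (h1 : γ < 1) {R : ℝ} (hR : 0 < R) :
    ∃ C > (0:ℝ), ∀ k : ℝ, R + 1 ≤ k → ∀ r : ℝ, r ≤ R →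
      0 ≤ Uf γ k r ∧ Uf γ k r ≤ C * k ^ (-(γ / (1 - γ))) := by
  have ha : 0 < (1 - γ) / γ := div_pos (by linarith) h0
  have hc : 0 < (1 - γ) / γ / (R + 1) := by positivity
  refine ⟨((1 - γ) / γ / (R + 1)) ^ (γ / (γ - 1)), Real.rpow_pos_of_pos hc _, ?_⟩
  intro k hk r hr
  have hkpos : 0 < k := by linarith
  have hS := Sf_ge_one h0 h1 (show r ≤ k by linarith)
  refine ⟨Real.rpow_nonneg (by linarith) _, ?_⟩
  have e : -(γ / (1 - γ)) = γ / (γ - 1) := by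
    rw [← div_neg]; congr 1; ring
  rw [e, ← Real.mul_rpow hc.le hkpos.le]
  refine Real.rpow_le_rpow_of_nonpos (by positivity) ?_ (b_neg h0 h1).le
  rw [Sf_eq h0 h1]
  have h3 : k / (R + 1) ≤ k - r := by
    rw [div_le_iff₀ (by linarith)]
    nlinarith
  have := mul_le_mul_of_nonneg_left h3 ha.le
  have e2 : (1 - γ) / γ / (R + 1) * k = (1 - γ) / γ * (k / (R + 1)) := by ring
  linarith

/-- Proposition 4.2: for `H(p) = -|p|^γ` for `|p| ≤ 1` (extended by a coercive `f ≥ -1`),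
the explicit function is the unique state-constraint solution on `B(0,k)`, and the rate of
convergence to `0` is `O(k^{-γ/(1-γ)})`. -/
theorem holder_hamiltonian_explicit_solution {n : ℕ} (hn : 1 ≤ n)
    (γ : ℝ) (hγ0 : 0 < γ) (hγ1 : γ < 1)
    (H : Euc n → ℝ) (hHcont : Continuous H)
    (hHcoer : ∀ M : ℝ, ∃ R : ℝ, ∀ p : Euc n, R ≤ ‖p‖ → M ≤ H p)
    (hHsmall : ∀ p : Euc n, ‖p‖ ≤ 1 → H p = -(‖p‖ ^ γ))
    (hHbig : ∀ p : Euc n, 1 ≤ ‖p‖ → -1 ≤ H p) :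
    (∀ k : ℝ, 0 < k →
      IsStateConstraintSolution (ball (0 : Euc n) k) (fun _ p => H p)
        (fun x => (((1 - γ) / γ) * (k + γ / (1 - γ) - ‖x‖)) ^ (γ / (γ - 1))) ∧
      ∀ v : Euc n → ℝ,
        IsStateConstraintSolution (ball (0 : Euc n) k) (fun _ p => H p) v →
        EqOn v (fun x => (((1 - γ) / γ) * (k + γ / (1 - γ) - ‖x‖)) ^ (γ / (γ - 1)))
          (closure (ball (0 : Euc n) k))) ∧
    ∀ R > (0:ℝ), ∃ C > (0:ℝ), ∀ k : ℝ, R + 1 ≤ k → ∀ x : Euc n, ‖x‖ ≤ R →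
      0 ≤ (((1 - γ) / γ) * (k + γ / (1 - γ) - ‖x‖)) ^ (γ / (γ - 1)) ∧
      (((1 - γ) / γ) * (k + γ / (1 - γ) - ‖x‖)) ^ (γ / (γ - 1)) ≤ C * k ^ (-(γ / (1 - γ))) := by
  refine ⟨fun k hk => ⟨u_sol hn hγ0 hγ1 hk hHsmall hHbig, ?_⟩, ?_⟩
  · rintro v ⟨hc, hsub, hsup⟩ x hx
    exact le_antisymm (v_le hγ0 hγ1 hk hHsmall hHbig hc hsub x hx)
      (v_ge hn hγ0 hγ1 hk hHsmall hc hsup x hx)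
  · intro R hR
    obtain ⟨C, hC, h⟩ := rate hγ0 hγ1 hR
    exact ⟨C, hC, fun k hk x hx => h k hk ‖x‖ hx⟩
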